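/- arXiv:1306.3362 — 2 statements merged into one kernel-verified Lean document; each statement's English description precedes it below -/
import Mathlib

section
/- For every d ≥ 1 there is a constant C_d > 0 with the following property: for all n ≥ 1 and all s, p_1,…,p_d ∈ [1,∞], there exist signs ε : {1,…,n}^{d+1} → {−1, +1} such that the d-linear map A : ℓ_{p_1}^n × ⋯ × ℓ_{p_d}^n → ℓ_s^n defined by A(z^{(1)},…,z^{(d)}) = Σ_{i_1,…,i_d,i_{d+1}=1}^{n} ε(i_1,…,i_{d+1}) z^{(1)}_{i_1} ⋯ z^{(d)}_{i_d} e_{i_{d+1}} satisfies ‖A‖ ≤ C_d · n^{1/2 + α(p_1) + ⋯ + α(p_d) + α(s^*)}, where s^* is the conjugate exponent of s, and α(p) = 1/2 − 1/p if p ≥ 2 and α(p) = 0 if p < 2 (with α(∞) = 1/2). -/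
open scoped ENNReal NNReal

/-- The exponent `α(p)`: `α(p) = 1/2 - 1/p` if `p ≥ 2` (so `α(∞) = 1/2`), and `α(p) = 0`
if `p < 2`. -/
noncomputable def alphExp (p : ℝ≥0∞) : ℝ := if 2 ≤ p then 1 / 2 - (p⁻¹).toReal else 0

/-- Among `n` coordinates, the `ℓ_q` norm is dominated by the `ℓ_p` norm when `p ≤ q`. -/
theorem PiLp.norm_toLp_le_norm_toLp {n : ℕ} {p q : ℝ≥0∞} [hp : Fact (1 ≤ p)] [Fact (1 ≤ q)]
    (hpq : p ≤ q) (x : Fin n → ℂ) :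
    ‖WithLp.toLp q x‖ ≤ ‖WithLp.toLp p x‖ := by
  have hcoord : ∀ i, ‖x i‖ ≤ ‖WithLp.toLp p x‖ := fun i =>
    PiLp.norm_apply_le (WithLp.toLp p x) i
  by_cases hq : q = ∞
  · subst hq
    rw [PiLp.norm_toLp]
    exact (pi_norm_le_iff_of_nonneg (norm_nonneg _)).2 hcoord
  have hp' : p ≠ ∞ := ne_top_of_le_ne_top hq hpq
  have hP : 1 ≤ p.toReal := by simpa using ENNReal.toReal_mono hp' hp.out
  have hPQ : p.toReal ≤ q.toReal := ENNReal.toReal_mono hq hpq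
  have hsum : ∑ i, ‖x i‖ ^ p.toReal = ‖WithLp.toLp p x‖ ^ p.toReal := by
    rw [PiLp.norm_eq_sum (by linarith), ← Real.rpow_mul (by positivity),
      one_div_mul_cancel (by linarith), Real.rpow_one]
  rw [PiLp.norm_eq_sum (p := q) (by linarith)]
  refine (Real.rpow_le_rpow (by positivity)
    (y := ‖WithLp.toLp p x‖ ^ q.toReal) ?_ (by positivity)).trans_eq ?_
  · calc ∑ i, ‖x i‖ ^ q.toReal
        ≤ ∑ i, ‖WithLp.toLp p x‖ ^ (q.toReal - p.toReal) * ‖x i‖ ^ p.toReal := by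
          refine Finset.sum_le_sum fun i _ => ?_
          rw [show q.toReal = (q.toReal - p.toReal) + p.toReal by ring,
            Real.rpow_add_of_nonneg (norm_nonneg _) (by linarith) (by linarith), add_sub_cancel_right]
          gcongr
          exact hcoord i
      _ = ‖WithLp.toLp p x‖ ^ q.toReal := by
          rw [← Finset.mul_sum, hsum,
            ← Real.rpow_add_of_nonneg (norm_nonneg _) (by linarith) (by linarith),
            sub_add_cancel]
  · rw [← Real.rpow_mul (norm_nonneg _), mul_one_div_cancel (by linarith), Real.rpow_one]

/-- Hölder's comparison of the `ℓ_p` and `ℓ_q` norms on `n` coordinates when `p ≤ q`. -/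
theorem PiLp.norm_toLp_le_rpow_mul_norm_toLp {n : ℕ} (hn : 1 ≤ n) {p q : ℝ≥0∞}
    [hp : Fact (1 ≤ p)] [Fact (1 ≤ q)] (hpq : p ≤ q) (x : Fin n → ℂ) :
    ‖WithLp.toLp p x‖ ≤
      (n : ℝ) ^ ((p⁻¹).toReal - (q⁻¹).toReal) * ‖WithLp.toLp q x‖ := by
  have hn0 : (0 : ℝ) < n := by exact_mod_cast hn
  by_cases hp' : p = ∞
  · subst hp'
    obtain rfl : q = ∞ := top_le_iff.1 hpq
    simp
  have hP : 1 ≤ p.toReal := by simpa using ENNReal.toReal_mono hp' hp.out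
  have key : ∑ i, ‖x i‖ ^ p.toReal ≤
      ((n : ℝ) ^ ((p⁻¹).toReal - (q⁻¹).toReal) * ‖WithLp.toLp q x‖) ^ p.toReal := by
    by_cases hq : q = ∞
    · subst hq
      calc ∑ i, ‖x i‖ ^ p.toReal ≤ ∑ _i : Fin n, ‖WithLp.toLp ∞ x‖ ^ p.toReal := by
            refine Finset.sum_le_sum fun i _ => ?_
            gcongr
            exact PiLp.norm_apply_le (WithLp.toLp ∞ x) i
        _ = _ := by
            rw [Real.mul_rpow (by positivity) (norm_nonneg _), ← Real.rpow_mul hn0.le]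
            simp [ENNReal.toReal_inv, inv_mul_cancel₀ (show p.toReal ≠ 0 by linarith)]
    · have hPQ : p.toReal ≤ q.toReal := ENNReal.toReal_mono hq hpq
      have hQ : 0 < q.toReal := by linarith
      have hr : 1 ≤ q.toReal / p.toReal := (one_le_div (by linarith)).2 hPQ
      have h := Real.rpow_sum_le_const_mul_sum_rpow_of_nonneg (s := Finset.univ)
        (f := fun i => ‖x i‖ ^ p.toReal) hr (fun i _ => by positivity)
      have hpow : ∀ i, (‖x i‖ ^ p.toReal) ^ (q.toReal / p.toReal) = ‖x i‖ ^ q.toReal := by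
        intro i
        rw [← Real.rpow_mul (norm_nonneg _), mul_div_cancel₀ _ (by linarith)]
      simp only [hpow, Finset.card_univ, Fintype.card_fin] at h
      have hsum : ∑ i, ‖x i‖ ^ q.toReal = ‖WithLp.toLp q x‖ ^ q.toReal := by
        rw [PiLp.norm_eq_sum hQ, ← Real.rpow_mul (by positivity),
          one_div_mul_cancel (by linarith), Real.rpow_one]
      rw [hsum] at h
      rw [← Real.rpow_le_rpow_iff (z := q.toReal / p.toReal) (by positivity) (by positivity)
        (by linarith), ← Real.rpow_mul (by positivity), mul_div_cancel₀ _ (by linarith),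
        Real.mul_rpow (by positivity) (norm_nonneg _), ← Real.rpow_mul hn0.le]
      convert h using 3
      rw [ENNReal.toReal_inv, ENNReal.toReal_inv]
      field_simp
  rw [PiLp.norm_eq_sum (p := p) (by linarith)]
  refine (Real.rpow_le_rpow (by positivity) key (by positivity)).trans_eq ?_
  rw [← Real.rpow_mul (by positivity), mul_one_div_cancel (by linarith), Real.rpow_one]

theorem norm_toLp_two_le_rpow_alphExp_mul {n : ℕ} (hn : 1 ≤ n) (p : ℝ≥0∞) [Fact (1 ≤ p)]
    (x : Fin n → ℂ) :
    ‖WithLp.toLp 2 x‖ ≤ (n : ℝ) ^ alphExp p * ‖WithLp.toLp p x‖ := by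
  unfold alphExp
  split_ifs with h
  · simpa using PiLp.norm_toLp_le_rpow_mul_norm_toLp hn h x
  · simpa using PiLp.norm_toLp_le_norm_toLp (not_le.1 h).le x

theorem norm_toLp_le_rpow_alphExp_conj_mul {n : ℕ} (hn : 1 ≤ n) {s t : ℝ≥0∞} [hs : Fact (1 ≤ s)]
    (hst : s⁻¹ + t⁻¹ = 1) (x : Fin n → ℂ) :
    ‖WithLp.toLp s x‖ ≤ (n : ℝ) ^ alphExp t * ‖WithLp.toLp 2 x‖ := by
  have hs1 : s⁻¹ ≠ ∞ := fun h => by simp [h] at hst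
  have ht1 : t⁻¹ ≠ ∞ := fun h => by simp [h] at hst
  have hr : (s⁻¹).toReal + (t⁻¹).toReal = 1 := by
    rw [← ENNReal.toReal_add hs1 ht1, hst, ENNReal.toReal_one]
  have h2 : ((2 : ℝ≥0∞)⁻¹).toReal = 1 / 2 := by simp
  have h2t : ((2 : ℝ≥0∞)⁻¹) ≠ ∞ := by simp
  unfold alphExp
  split_ifs with h
  · have ht : (t⁻¹).toReal ≤ 1 / 2 := by
      rw [← h2]; exact ENNReal.toReal_mono h2t (ENNReal.inv_le_inv.2 h)
    have hs2 : s ≤ 2 := by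
      rw [← ENNReal.inv_le_inv, ← ENNReal.toReal_le_toReal h2t hs1, h2]; linarith
    have := PiLp.norm_toLp_le_rpow_mul_norm_toLp hn hs2 x
    rwa [h2, show (s⁻¹).toReal - 1 / 2 = 1 / 2 - (t⁻¹).toReal by linarith] at this
  · have ht : 1 / 2 ≤ (t⁻¹).toReal := by
      rw [← h2]; exact ENNReal.toReal_mono ht1 (ENNReal.inv_le_inv.2 (not_le.1 h).le)
    have hs2 : 2 ≤ s := by
      rw [← ENNReal.inv_le_inv, ← ENNReal.toReal_le_toReal hs1 h2t, h2]; linarith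
    simpa using PiLp.norm_toLp_le_norm_toLp hs2 x

/-- The ball of radius `2` of a finite-dimensional real normed space has a `1`-net of at most
`5 ^ dim` points. -/
theorem exists_finset_one_net (E : Type*) [NormedAddCommGroup E] [NormedSpace ℝ E]
    [FiniteDimensional ℝ E] :
    ∃ N : Finset E, N.card ≤ 5 ^ Module.finrank ℝ E ∧ (∀ c ∈ N, ‖c‖ ≤ 2) ∧
      ∀ x : E, ‖x‖ ≤ 2 → ∃ c ∈ N, ‖x - c‖ ≤ 1 := by
  classical
  let P : Finset E → Prop := fun s =>
    (∀ c ∈ s, ‖c‖ ≤ 2) ∧ ∀ c ∈ s, ∀ d ∈ s, c ≠ d → 1 ≤ ‖c - d‖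
  have hbd : ∀ s, P s → s.card ≤ 5 ^ Module.finrank ℝ E := fun s hs =>
    Besicovitch.card_le_of_separated s hs.1 hs.2
  let Q : ℕ → Prop := fun k => ∃ s, P s ∧ s.card = k
  have hQ0 : Q 0 := ⟨∅, by simp [P], rfl⟩
  obtain ⟨N, hN, hcard⟩ : Q (Nat.findGreatest Q (5 ^ Module.finrank ℝ E)) :=
    Nat.findGreatest_spec (Nat.zero_le _) hQ0
  refine ⟨N, hbd N hN, hN.1, fun x hx => ?_⟩
  by_contra! hfar
  have hxN : x ∉ N := fun h => by simpa using (hfar x h).trans_le' zero_le_one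
  have hins : P (insert x N) := by
    refine ⟨?_, ?_⟩
    · intro c hc
      rcases Finset.mem_insert.1 hc with rfl | hc
      exacts [hx, hN.1 c hc]
    · intro c hc e he hne
      rcases Finset.mem_insert.1 hc with hc | hc <;> rcases Finset.mem_insert.1 he with he | he
      · exact absurd (hc.trans he.symm) hne
      · rw [hc]; exact (hfar e he).le
      · rw [he, norm_sub_rev]; exact (hfar c hc).le
      · exact hN.2 c hc e he hne
  have := Nat.le_findGreatest (P := Q) (hbd _ hins) ⟨_, hins, rfl⟩
  rw [Finset.card_insert_of_notMem hxN] at this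
  omega

/-- A linear functional bounded by `M` on a `1`-net of the ball of radius `2` has norm at most
`M`. -/
theorem ContinuousLinearMap.opNorm_le_of_one_net {E : Type*} [NormedAddCommGroup E]
    [NormedSpace ℂ E] {N : Finset E} (hN : ∀ x : E, ‖x‖ ≤ 2 → ∃ c ∈ N, ‖x - c‖ ≤ 1)
    (f : E →L[ℂ] ℂ) {M : ℝ} (hM : 0 ≤ M) (hf : ∀ c ∈ N, ‖f c‖ ≤ M) : ‖f‖ ≤ M := by
  have h : ‖f‖ ≤ (M + ‖f‖) / 2 := by
    refine f.opNorm_le_bound (by positivity) fun x => ?_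
    rcases eq_or_ne x 0 with rfl | hx
    · simp
    have hx0 : 0 < ‖x‖ := norm_pos_iff.2 hx
    have hnorm : ‖((2 / ‖x‖ : ℝ) : ℂ)‖ = 2 / ‖x‖ := by
      rw [Complex.norm_real, Real.norm_of_nonneg (by positivity)]
    obtain ⟨c, hc, hxc⟩ := hN (((2 / ‖x‖ : ℝ) : ℂ) • x) (by
      rw [norm_smul, hnorm, div_mul_cancel₀ _ hx0.ne'])
    have h1 : ‖f (((2 / ‖x‖ : ℝ) : ℂ) • x)‖ ≤ M + ‖f‖ := by
      rw [← sub_add_cancel (((2 / ‖x‖ : ℝ) : ℂ) • x) c, map_add, add_comm]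
      refine (norm_add_le _ _).trans (add_le_add (hf c hc) ?_)
      exact (f.le_opNorm _).trans (mul_le_of_le_one_right (norm_nonneg _) hxc)
    rw [map_smul, norm_smul, hnorm, div_mul_eq_mul_div, div_le_iff₀ hx0] at h1
    linarith
  linarith

/-- A multilinear form bounded by `M` on a `1`-net of the ball of radius `2` has norm at most
`M`. -/
theorem ContinuousMultilinearMap.norm_apply_le_of_one_net {ι E : Type*} [Fintype ι]
    [NormedAddCommGroup E] [NormedSpace ℂ E] {N : Finset E}
    (hN : ∀ x : E, ‖x‖ ≤ 2 → ∃ c ∈ N, ‖x - c‖ ≤ 1)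
    (f : ContinuousMultilinearMap ℂ (fun _ : ι => E) ℂ) {M : ℝ} (hM : 0 ≤ M)
    (hf : ∀ x : ι → E, (∀ k, x k ∈ N) → ‖f x‖ ≤ M) (x : ι → E) :
    ‖f x‖ ≤ M * ∏ k, ‖x k‖ := by
  classical
  suffices H : ∀ (S : Finset ι) (x : ι → E), (∀ k ∉ S, x k ∈ N) →
      ‖f x‖ ≤ M * ∏ k ∈ S, ‖x k‖ from H Finset.univ x (by simp)
  intro S
  induction S using Finset.induction_on with
  | empty => intro x hx; simpa using hf x (by simpa using hx)
  | insert a S ha ih =>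
    intro x hx
    have hnorm : ‖f.toContinuousLinearMap x a‖ ≤ M * ∏ k ∈ S, ‖x k‖ := by
      refine ContinuousLinearMap.opNorm_le_of_one_net hN _ (by positivity) fun c hc => ?_
      refine (ih (Function.update x a c) fun k hk => ?_).trans_eq ?_
      · rcases eq_or_ne k a with rfl | hka
        · simpa using hc
        · rw [Function.update_of_ne hka]
          exact hx k (by simp [hka, hk])
      · congr 1
        refine Finset.prod_congr rfl fun k hk => ?_
        rw [Function.update_of_ne (ne_of_mem_of_not_mem hk ha)]
    have := (f.toContinuousLinearMap x a).le_of_opNorm_le hnorm (x a)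
    simp only [ContinuousMultilinearMap.toContinuousLinearMap_apply,
      Function.update_eq_self] at this
    rw [Finset.prod_insert ha]
    linarith

/-- The real sign attached to a Boolean. -/
def boolSign (b : Bool) : ℝ := if b then 1 else -1

/-- The subgaussian bound for the exponential moments of a Rademacher sum. -/
theorem sum_exp_rademacher_le {ι : Type*} [Fintype ι] [DecidableEq ι] (a : ι → ℝ) :
    ∑ ε : ι → Bool, Real.exp (∑ i, boolSign (ε i) * a i) ≤
      2 ^ Fintype.card ι * Real.exp ((∑ i, a i ^ 2) / 2) := by
  have h := Finset.prod_univ_sum (R := ℝ) (fun _ : ι => (Finset.univ : Finset Bool))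
    (fun i b => Real.exp (boolSign b * a i))
  rw [Fintype.piFinset_univ] at h
  simp only [Real.exp_sum]
  rw [← h, Finset.sum_div, Real.exp_sum, ← Finset.card_univ, ← Finset.prod_const,
    ← Finset.prod_mul_distrib]
  refine Finset.prod_le_prod (fun i _ => by positivity) fun i _ => ?_
  have := Real.cosh_le_exp_half_sq (a i)
  rw [Real.cosh_eq] at this
  simp only [Fintype.sum_bool, boolSign]
  norm_num
  linarith

/-- Some choice of signs makes finitely many Rademacher sums with coefficients of bounded `ℓ_2`
norm simultaneously small. -/
theorem exists_sign_forall_abs_sum_le {ι κ : Type*} [Fintype ι] (T : Finset κ) (hT : T.Nonempty)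
    (a : κ → ι → ℝ) {V : ℝ} (ha : ∀ x ∈ T, ∑ i, a x i ^ 2 ≤ V) {l : ℝ} (hl : 0 < l) :
    ∃ ε : ι → Bool, ∀ x ∈ T,
      l * |∑ i, boolSign (ε i) * a x i| ≤ Real.log (2 * T.card) + l ^ 2 * V / 2 := by
  classical
  have hcard : (0 : ℝ) < T.card := by exact_mod_cast hT.card_pos
  have hone : ∀ x ∈ T, ∀ σ : ℝ, σ ^ 2 = l ^ 2 →
      ∑ ε : ι → Bool, Real.exp (σ * ∑ i, boolSign (ε i) * a x i) ≤
        2 ^ Fintype.card ι * Real.exp (l ^ 2 * V / 2) := by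
    intro x hx σ hσ
    have h := sum_exp_rademacher_le (fun i => σ * a x i)
    have hexp : ∀ ε : ι → Bool, ∑ i, boolSign (ε i) * (σ * a x i) =
        σ * ∑ i, boolSign (ε i) * a x i := fun ε => by
      rw [Finset.mul_sum]; exact Finset.sum_congr rfl fun i _ => by ring
    simp only [hexp] at h
    refine h.trans ?_
    gcongr
    simp only [mul_pow, hσ, ← Finset.mul_sum]
    gcongr
    exact ha x hx
  have htot : ∑ ε : ι → Bool, ∑ x ∈ T, (Real.exp (l * ∑ i, boolSign (ε i) * a x i) +
      Real.exp (-l * ∑ i, boolSign (ε i) * a x i)) ≤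
      ∑ _ε : ι → Bool, 2 * T.card * Real.exp (l ^ 2 * V / 2) := by
    rw [Finset.sum_comm]
    calc _ ≤ ∑ x ∈ T, (2 ^ Fintype.card ι * Real.exp (l ^ 2 * V / 2) +
          2 ^ Fintype.card ι * Real.exp (l ^ 2 * V / 2)) := by
          refine Finset.sum_le_sum fun x hx => ?_
          rw [Finset.sum_add_distrib]
          exact add_le_add (hone x hx l rfl) (hone x hx (-l) (by ring))
      _ = _ := by
          simp
          ring
  obtain ⟨ε, -, hε⟩ := Finset.exists_le_of_sum_le Finset.univ_nonempty htot
  refine ⟨ε, fun x hx => ?_⟩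
  have hx' := (Finset.single_le_sum (f := fun x =>
    Real.exp (l * ∑ i, boolSign (ε i) * a x i) + Real.exp (-l * ∑ i, boolSign (ε i) * a x i))
    (fun y _ => by positivity) hx).trans hε
  rw [← Real.exp_log (show (0 : ℝ) < 2 * T.card by positivity), ← Real.exp_add] at hx'
  have hp := Real.exp_pos (l * ∑ i, boolSign (ε i) * a x i)
  have hm := Real.exp_pos (-l * ∑ i, boolSign (ε i) * a x i)
  have h1 := Real.exp_le_exp.1 (by linarith : Real.exp (l * ∑ i, boolSign (ε i) * a x i) ≤ _)
  have h2 := Real.exp_le_exp.1 (by linarith : Real.exp (-l * ∑ i, boolSign (ε i) * a x i) ≤ _)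
  rcases abs_cases (∑ i, boolSign (ε i) * a x i) with ⟨h, -⟩ | ⟨h, -⟩ <;> rw [h] <;> linarith

/-- The multilinear form on `ℂⁿ × ⋯ × ℂⁿ` with coefficients `c`. -/
noncomputable def coeffForm {m n : ℕ} (c : (Fin m → Fin n) → ℂ) :
    ContinuousMultilinearMap ℂ (fun _ : Fin m => EuclideanSpace ℂ (Fin n)) ℂ :=
  ∑ i, c i • (ContinuousMultilinearMap.mkPiAlgebra ℂ (Fin m) ℂ).compContinuousLinearMap
    (fun k => EuclideanSpace.proj (i k))

theorem coeffForm_apply {m n : ℕ} (c : (Fin m → Fin n) → ℂ)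
    (x : Fin m → EuclideanSpace ℂ (Fin n)) :
    coeffForm c x = ∑ i, c i * ∏ k, x k (i k) := by
  simp [coeffForm]

theorem coeffForm_snoc {d n : ℕ} (c : (Fin (d + 1) → Fin n) → ℂ)
    (x : Fin d → EuclideanSpace ℂ (Fin n)) (w : EuclideanSpace ℂ (Fin n)) :
    coeffForm c (Fin.snoc x w : Fin (d + 1) → EuclideanSpace ℂ (Fin n)) =
      ∑ j, (∑ i : Fin d → Fin n, c (Fin.snoc i j) * ∏ k, x k (i k)) * w j := by
  rw [coeffForm_apply, ← (Fin.snocEquiv fun _ => Fin n).sum_comp, Fintype.sum_prod_type]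
  refine Finset.sum_congr rfl fun j _ => ?_
  rw [Finset.sum_mul]
  refine Finset.sum_congr rfl fun i _ => ?_
  rw [Fin.prod_univ_castSucc]
  simp only [Fin.snocEquiv, Equiv.coe_fn_mk, Fin.snoc_castSucc, Fin.snoc_last]
  ring

/-- A bound for a `(d + 1)`-linear form on `ℓ_2` bounds the associated `ℓ_2`-valued `d`-linear
map. -/
theorem norm_toLp_two_le_of_norm_coeffForm_le {d n : ℕ} {c : (Fin (d + 1) → Fin n) → ℂ} {B : ℝ}
    (hB : 0 ≤ B)
    (h : ∀ x : Fin (d + 1) → EuclideanSpace ℂ (Fin n), ‖coeffForm c x‖ ≤ B * ∏ k, ‖x k‖)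
    (x : Fin d → EuclideanSpace ℂ (Fin n)) :
    ‖WithLp.toLp 2 fun j => ∑ i : Fin d → Fin n, c (Fin.snoc i j) * ∏ k, x k (i k)‖ ≤
      B * ∏ k, ‖x k‖ := by
  generalize hy : (fun j => ∑ i : Fin d → Fin n, c (Fin.snoc i j) * ∏ k, x k (i k)) = y
  let w : EuclideanSpace ℂ (Fin n) := WithLp.toLp 2 fun j => (starRingEnd ℂ) (y j)
  have hw : ‖w‖ = ‖WithLp.toLp 2 y‖ := by simp [w, EuclideanSpace.norm_eq]
  have hform : coeffForm c (Fin.snoc x w : Fin (d + 1) → EuclideanSpace ℂ (Fin n)) =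
      ((‖WithLp.toLp 2 y‖ ^ 2 : ℝ) : ℂ) := by
    rw [coeffForm_snoc, EuclideanSpace.norm_sq_eq, Complex.ofReal_sum]
    refine Finset.sum_congr rfl fun j _ => ?_
    rw [Complex.ofReal_pow, ← Complex.mul_conj']
    exact congrArg (· * w j) (congrFun hy j)
  have hx := h (Fin.snoc x w : Fin (d + 1) → EuclideanSpace ℂ (Fin n))
  rw [hform, Fin.prod_univ_castSucc, Complex.norm_real, Real.norm_of_nonneg (by positivity)] at hx
  simp only [Fin.snoc_castSucc, Fin.snoc_last, hw] at hx
  rcases (norm_nonneg (WithLp.toLp 2 y)).eq_or_lt with h0 | h0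
  · exact h0.ge.trans (mul_nonneg hB (Finset.prod_nonneg fun k _ => norm_nonneg _))
  · refine le_of_mul_le_mul_right ?_ h0
    linarith

theorem sum_norm_prod_sq_eq {m n : ℕ} (x : Fin m → EuclideanSpace ℂ (Fin n)) :
    ∑ i : Fin m → Fin n, ‖∏ k, x k (i k)‖ ^ 2 = ∏ k, ‖x k‖ ^ 2 := by
  have h := Finset.prod_univ_sum (R := ℝ) (fun _ : Fin m => (Finset.univ : Finset (Fin n)))
    (fun k j => ‖x k j‖ ^ 2)
  rw [Fintype.piFinset_univ] at h
  simp only [EuclideanSpace.norm_sq_eq, h, norm_prod, Finset.prod_pow]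

/-- Some `±1` tensor of order `m` on `ℂⁿ` has injective norm `O(√n)`. -/
theorem exists_sign_norm_coeffForm_le (m : ℕ) {n : ℕ} (hn : 1 ≤ n) :
    ∃ ε : (Fin m → Fin n) → Bool, ∀ x : Fin m → EuclideanSpace ℂ (Fin n),
      ‖coeffForm (fun i => (boolSign (ε i) : ℂ)) x‖ ≤
        2 * (2 + 4 * m + 4 ^ m) * √n * ∏ k, ‖x k‖ := by
  classical
  have hn1 : (1 : ℝ) ≤ n := by exact_mod_cast hn
  have hsn : 0 < √(n : ℝ) := Real.sqrt_pos.2 (by linarith)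
  obtain ⟨N, hNcard, hN2, hN⟩ := exists_finset_one_net (EuclideanSpace ℂ (Fin n))
  have hfin : Module.finrank ℝ (EuclideanSpace ℂ (Fin n)) = 2 * n := by
    rw [finrank_real_of_complex, finrank_euclideanSpace_fin]
  rw [hfin] at hNcard
  obtain ⟨c₀, hc₀, -⟩ := hN 0 (by simp)
  have hNpos : 0 < N.card := Finset.card_pos.2 ⟨c₀, hc₀⟩
  let T : Finset ((Fin m → EuclideanSpace ℂ (Fin n)) × Bool) :=
    Fintype.piFinset (fun _ => N) ×ˢ Finset.univ
  let a : (Fin m → EuclideanSpace ℂ (Fin n)) × Bool → (Fin m → Fin n) → ℝ := fun y i =>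
    if y.2 then (∏ k, y.1 k (i k)).re else (∏ k, y.1 k (i k)).im
  have hTcard : T.card = N.card ^ m * 2 := by simp [T]
  have hTne : T.Nonempty := Finset.card_pos.1 (by rw [hTcard]; positivity)
  have ha : ∀ y ∈ T, ∑ i, a y i ^ 2 ≤ 4 ^ m := by
    rintro ⟨x, b⟩ hy
    have hx : ∀ k, x k ∈ N := by simpa [T] using hy
    calc ∑ i, a (x, b) i ^ 2 ≤ ∑ i : Fin m → Fin n, ‖∏ k, x k (i k)‖ ^ 2 := by
          refine Finset.sum_le_sum fun i _ => ?_
          rw [← sq_abs]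
          gcongr
          cases b
          · exact Complex.abs_im_le_norm _
          · exact Complex.abs_re_le_norm _
      _ = ∏ k, ‖x k‖ ^ 2 := sum_norm_prod_sq_eq x
      _ ≤ ∏ _k : Fin m, (4 : ℝ) := by
          refine Finset.prod_le_prod (fun k _ => by positivity) fun k _ => ?_
          have := hN2 _ (hx k)
          nlinarith [norm_nonneg (x k)]
      _ = 4 ^ m := by simp
  obtain ⟨ε, hε⟩ := exists_sign_forall_abs_sum_le T hTne a ha hsn
  have hlog : Real.log (2 * T.card) ≤ (2 + 4 * m) * n := by
    rw [Real.log_le_iff_le_exp (by have := hTne.card_pos; positivity)]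
    have he : (2 : ℝ) ≤ Real.exp 1 := by linarith [Real.add_one_le_exp (1 : ℝ)]
    have he5 : (5 : ℝ) ≤ Real.exp 2 := by
      rw [show (2 : ℝ) = 1 + 1 by norm_num, Real.exp_add]
      nlinarith [Real.exp_one_gt_d9]
    have h4 : (4 : ℝ) ≤ Real.exp (2 * n) := by
      calc (4 : ℝ) ≤ Real.exp 2 := by linarith
        _ ≤ _ := Real.exp_le_exp.2 (by linarith)
    have hNm : (N.card : ℝ) ^ m ≤ Real.exp (4 * m * n) := by
      calc (N.card : ℝ) ^ m ≤ ((5 : ℝ) ^ (2 * n)) ^ m := by gcongr; exact_mod_cast hNcard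
        _ ≤ (Real.exp 2 ^ (2 * n)) ^ m := by gcongr
        _ = Real.exp (4 * m * n) := by
            rw [← pow_mul, ← Real.exp_nat_mul]; congr 1; push_cast; ring
    rw [hTcard, show (2 + 4 * (m : ℝ)) * n = 2 * n + 4 * m * n by ring, Real.exp_add]
    push_cast
    have := mul_le_mul h4 hNm (by positivity) (Real.exp_pos _).le
    linarith
  have hbound : ∀ y ∈ T, |∑ i, boolSign (ε i) * a y i| ≤ (2 + 4 * m + 4 ^ m) * √n := by
    intro y hy
    have h := hε y hy
    rw [Real.sq_sqrt (by linarith)] at h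
    have hs : √(n : ℝ) * √n = n := Real.mul_self_sqrt (by linarith)
    refine le_of_mul_le_mul_left ?_ hsn
    have h4 : (0 : ℝ) ≤ n * 4 ^ m := by positivity
    calc _ ≤ (2 + 4 * (m : ℝ)) * n + n * 4 ^ m / 2 := h.trans (by linarith)
      _ ≤ (2 + 4 * m + 4 ^ m) * (√(n : ℝ) * √n) := by rw [hs]; linarith
      _ = _ := by ring
  refine ⟨ε, ContinuousMultilinearMap.norm_apply_le_of_one_net hN _ (by positivity)
    fun x hx => ?_⟩
  refine (Complex.norm_le_abs_re_add_abs_im _).trans ?_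
  have hre := hbound (x, true) (by simpa [T] using hx)
  have him := hbound (x, false) (by simpa [T] using hx)
  simp only [a, if_true, Bool.false_eq_true, if_false] at hre him
  rw [coeffForm_apply]
  simp only [Complex.re_sum, Complex.im_sum, Complex.re_ofReal_mul, Complex.im_ofReal_mul]
  linarith

/-- **Lemma 6.2 (vector-valued Kahane–Salem–Zygmund-type inequality).** For every `d ≥ 1` there
is `C_d > 0` such that for all `n ≥ 1`, all `s, p₁, …, p_d ∈ [1,∞]` (`s*` the conjugate exponent
of `s`), there are signs `ε : {1,…,n}^{d+1} → {±1}` for which the `d`-linear map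
`A(z⁽¹⁾,…,z⁽ᵈ⁾) = Σ_{i,i_{d+1}} ε(i,i_{d+1}) z⁽¹⁾_{i₁} ⋯ z⁽ᵈ⁾_{i_d} e_{i_{d+1}}` from
`ℓ_{p₁}^n × ⋯ × ℓ_{p_d}^n` to `ℓ_s^n` satisfies
`‖A‖ ≤ C_d n^{1/2 + α(p₁) + ⋯ + α(p_d) + α(s*)}`, i.e.
`‖A(z)‖_{ℓ_s^n} ≤ C_d n^{1/2 + Σ_k α(p_k) + α(s*)} ∏_k ‖z⁽ᵏ⁾‖` for all `z`. -/
theorem kahane_salem_zygmund_vector_valued (d : ℕ) (hd : 1 ≤ d) :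
    ∃ C : ℝ, 0 < C ∧
      ∀ (n : ℕ), 1 ≤ n →
      ∀ (s sStar : ℝ≥0∞) [Fact (1 ≤ s)], s⁻¹ + sStar⁻¹ = 1 →
      ∀ (p : Fin d → ℝ≥0∞) [∀ k, Fact (1 ≤ p k)],
        ∃ ε : (Fin (d + 1) → Fin n) → ℝ,
          (∀ i, ε i = 1 ∨ ε i = -1) ∧
          ∀ z : (k : Fin d) → PiLp (p k) (fun _ : Fin n => ℂ),
            ‖(WithLp.equiv s (Fin n → ℂ)).symm (fun j =>
                ∑ i : Fin d → Fin n,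
                  (ε (Fin.snoc i j) : ℂ) *
                    ∏ k, (WithLp.equiv (p k) (Fin n → ℂ)) (z k) (i k))‖ ≤
              C * (n : ℝ) ^ (1 / 2 + (∑ k, alphExp (p k)) + alphExp sStar) * ∏ k, ‖z k‖ := by
  refine ⟨2 * (2 + 4 * (d + 1 : ℕ) + 4 ^ (d + 1)), by positivity, ?_⟩
  intro n hn s sStar _ hs p _
  have hn0 : (0 : ℝ) < n := by exact_mod_cast hn
  obtain ⟨ε, hε⟩ := exists_sign_norm_coeffForm_le (d + 1) hn
  refine ⟨fun i => boolSign (ε i), fun i => by simp only [boolSign]; split_ifs <;> simp, fun z => ?_⟩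
  set K : ℝ := 2 * (2 + 4 * (d + 1 : ℕ) + 4 ^ (d + 1))
  have hK0 : 0 ≤ K := by positivity
  let y : Fin n → ℂ := fun j => ∑ i : Fin d → Fin n,
    (boolSign (ε (Fin.snoc i j)) : ℂ) * ∏ k, z k (i k)
  let x : Fin d → EuclideanSpace ℂ (Fin n) := fun k => WithLp.toLp 2 (WithLp.ofLp (z k))
  have hy2 := norm_toLp_two_le_of_norm_coeffForm_le (by positivity) hε x
  have hx : ∏ k, ‖x k‖ ≤ (n : ℝ) ^ (∑ k, alphExp (p k)) * ∏ k, ‖z k‖ := by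
    rw [Real.rpow_sum_of_pos hn0, ← Finset.prod_mul_distrib]
    exact Finset.prod_le_prod (fun k _ => norm_nonneg _) fun k _ =>
      norm_toLp_two_le_rpow_alphExp_mul hn (p k) (WithLp.ofLp (z k))
  change ‖WithLp.toLp s y‖ ≤ _
  calc ‖WithLp.toLp s y‖ ≤ (n : ℝ) ^ alphExp sStar * ‖WithLp.toLp 2 y‖ :=
        norm_toLp_le_rpow_alphExp_conj_mul hn hs y
    _ ≤ (n : ℝ) ^ alphExp sStar *
        (K * √n * ((n : ℝ) ^ (∑ k, alphExp (p k)) * ∏ k, ‖z k‖)) := by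
        gcongr
        exact hy2.trans (by gcongr)
    _ = _ := by
        rw [Real.rpow_add hn0, Real.rpow_add hn0, ← Real.sqrt_eq_rpow]
        ring
end

section
/- Let m ≥ 2 and let p_1,…,p_{m−1} ∈ [2,∞] satisfy 1/p_1 + ⋯ + 1/p_{m−1} > 1/2, and let p_m ∈ [1,∞]. Then for every θ > 0 there is NO constant C > 0 such that, for all n ≥ 1 and all m-linear forms A : ℓ_{p_1}^n × ⋯ × ℓ_{p_m}^n → ℂ, ( Σ_{i_m=1}^{n} ( Σ_{i_1,…,i_{m−1}=1}^{n} |A(e_{i_1},…,e_{i_m})|² )^{θ/2} )^{1/θ} ≤ C ‖A‖. Hence the hypothesis 'Σ_{k≠l} 1/p_k ≤ 1/r − 1/2 for every l' cannot be removed from the mixed (ℓ_λ, ℓ_2)-norm inequality. -/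
open scoped ENNReal NNReal

/-- The canonical unit vector `e_i` of `ℓ_p^n` (`ℂ^n` with the `ℓ_p` norm). -/
noncomputable def lpUnit (p : ℝ≥0∞) (n : ℕ) [Fact (1 ≤ p)] (i : Fin n) :
    PiLp p (fun _ : Fin n => ℂ) :=
  (WithLp.equiv p (Fin n → ℂ)).symm (Pi.single i 1)

section

open Finset

/-- A generalized Hölder inequality on `n` points, with total weight at most one. -/
lemma sum_prod_rpow_le_card_rpow {ι : Type*} [Fintype ι] (n : ℕ) (hn : 1 ≤ n)
    (w : ι → ℝ) (b : ι → Fin n → ℝ) (hw : ∀ k, 0 ≤ w k) (hw1 : ∑ k, w k ≤ 1)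
    (hb : ∀ k i, 0 ≤ b k i) (hsum : ∀ k, w k * ∑ i, b k i ≤ w k) :
    ∑ i, ∏ k, b k i ^ w k ≤ (n : ℝ) ^ (1 - ∑ k, w k) := by
  have hn0 : (0 : ℝ) < n := by exact_mod_cast hn
  set σ := ∑ k, w k with hσ
  have amgm : ∀ i, ((n : ℝ)⁻¹) ^ (1 - σ) * ∏ k, b k i ^ w k
      ≤ (1 - σ) * (n : ℝ)⁻¹ + ∑ k, w k * b k i := by
    intro i
    have h := Real.geom_mean_le_arith_mean_weighted (univ : Finset (Option ι))
      (fun o => o.elim (1 - σ) w) (fun o => o.elim (n : ℝ)⁻¹ (fun k => b k i))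
      (by rintro (_ | k) _
          · simpa using hw1
          · exact hw k)
      (by simp [Fintype.sum_option, ← hσ])
      (by rintro (_ | k) _
          · simp
          · exact hb k i)
    simpa [Fintype.sum_option, Fintype.prod_option] using h
  have hle : ((n : ℝ)⁻¹) ^ (1 - σ) * ∑ i, ∏ k, b k i ^ w k ≤ 1 := by
    calc _ = ∑ i, ((n : ℝ)⁻¹) ^ (1 - σ) * ∏ k, b k i ^ w k := by rw [mul_sum]
      _ ≤ ∑ i : Fin n, ((1 - σ) * (n : ℝ)⁻¹ + ∑ k, w k * b k i) :=
          sum_le_sum fun i _ => amgm i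
      _ = (1 - σ) + ∑ k, w k * ∑ i, b k i := by
          rw [sum_add_distrib, sum_comm]
          simp only [mul_sum, sum_const, card_univ, Fintype.card_fin, nsmul_eq_mul]
          field_simp
      _ ≤ (1 - σ) + ∑ k, w k := by gcongr with k; exact hsum k
      _ = 1 := by rw [← hσ]; ring
  rw [Real.inv_rpow hn0.le] at hle
  have hpos : 0 < (n : ℝ) ^ (1 - σ) := Real.rpow_pos_of_pos hn0 _
  rwa [inv_mul_le_iff₀ hpos, mul_one] at hle

/-- The form `x ↦ ∑ i, ∏ k, x k (f k i)`. -/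
noncomputable def sumProdForm {m n : ℕ} (p : Fin m → ℝ≥0∞) [∀ k, Fact (1 ≤ p k)]
    (f : Fin m → Fin n → Fin n) :
    ContinuousMultilinearMap ℂ (fun k => PiLp (p k) (fun _ : Fin n => ℂ)) ℂ :=
  ∑ i, (ContinuousMultilinearMap.mkPiAlgebra ℂ (Fin m) ℂ).compContinuousLinearMap
    (fun k => PiLp.proj (p k) (fun _ : Fin n => ℂ) (f k i))

lemma sumProdForm_apply {m n : ℕ} (p : Fin m → ℝ≥0∞) [∀ k, Fact (1 ≤ p k)]
    (f : Fin m → Fin n → Fin n) (x : ∀ k, PiLp (p k) (fun _ : Fin n => ℂ)) :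
    sumProdForm p f x = ∑ i, ∏ k, x k (f k i) := by
  simp [sumProdForm]

lemma norm_coord_div_norm_le_one {n : ℕ} {p : ℝ≥0∞} [Fact (1 ≤ p)]
    (x : PiLp p (fun _ : Fin n => ℂ)) (i : Fin n) : ‖x i‖ / ‖x‖ ≤ 1 :=
  div_le_one_of_le₀ (PiLp.norm_apply_le x i) (norm_nonneg _)

lemma sum_norm_coord_div_norm_rpow_le_one {n : ℕ} {p : ℝ≥0∞} [Fact (1 ≤ p)] (hp : p ≠ ⊤)
    (x : PiLp p (fun _ : Fin n => ℂ)) : ∑ i, (‖x i‖ / ‖x‖) ^ p.toReal ≤ 1 := by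
  have hp0 : 0 < p.toReal :=
    ENNReal.toReal_pos (zero_lt_one.trans_le (Fact.out : 1 ≤ p)).ne' hp
  have hS : ∑ i, ‖x i‖ ^ p.toReal = ‖x‖ ^ p.toReal := by
    rw [PiLp.norm_eq_sum hp0, ← Real.rpow_mul (by positivity), one_div,
      inv_mul_cancel₀ hp0.ne', Real.rpow_one]
  simp_rw [Real.div_rpow (norm_nonneg _) (norm_nonneg _)]
  rw [← sum_div, hS]
  exact div_self_le_one _

/-- Norm bound for a form diagonal in all variables of positive weight. -/
lemma norm_sumProdForm_le {m n : ℕ} (hn : 1 ≤ n) (p : Fin m → ℝ≥0∞) [∀ k, Fact (1 ≤ p k)]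
    (f : Fin m → Fin n → Fin n) (w : Fin m → ℝ) (hw : ∀ k, 0 ≤ w k) (hw1 : ∑ k, w k ≤ 1)
    (hwp : ∀ k, w k ≤ (p k)⁻¹.toReal) (hf : ∀ k, w k = 0 ∨ ∀ i, f k i = i) :
    ‖sumProdForm p f‖ ≤ (n : ℝ) ^ (1 - ∑ k, w k) := by
  refine ContinuousMultilinearMap.opNorm_le_bound (by positivity) fun x => ?_
  rw [sumProdForm_apply]
  have hfac : ∀ k i, ‖x k i‖ = ‖x k i‖ / ‖x k‖ * ‖x k‖ := by
    intro k i
    refine (div_mul_cancel_of_imp fun h => ?_).symm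
    exact le_antisymm (h ▸ PiLp.norm_apply_le (x k) i) (norm_nonneg _)
  have hcoord : ∀ k i,
      ‖x k (f k i)‖ / ‖x k‖ ≤ ((‖x k i‖ / ‖x k‖) ^ (p k).toReal) ^ w k := by
    intro k i
    rcases hf k with h | h
    · rw [h, Real.rpow_zero]
      exact norm_coord_div_norm_le_one _ _
    · rw [h, ← Real.rpow_mul (by positivity)]
      have hexp : (p k).toReal * w k ≤ 1 := by
        calc (p k).toReal * w k ≤ (p k).toReal * (p k)⁻¹.toReal := by
              gcongr; exact hwp k
          _ ≤ 1 := by rw [ENNReal.toReal_inv]; exact mul_inv_le_one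
      simpa using Real.rpow_le_rpow_of_exponent_ge' (by positivity)
        (norm_coord_div_norm_le_one (x k) i) (mul_nonneg ENNReal.toReal_nonneg (hw k)) hexp
  calc ‖∑ i, ∏ k, x k (f k i)‖ ≤ ∑ i, ∏ k, ‖x k (f k i)‖ :=
        (norm_sum_le _ _).trans_eq (by simp [norm_prod])
    _ = (∑ i, ∏ k, ‖x k (f k i)‖ / ‖x k‖) * ∏ k, ‖x k‖ := by
        rw [sum_mul]
        refine sum_congr rfl fun i _ => ?_
        rw [← prod_mul_distrib]
        exact prod_congr rfl fun k _ => hfac k _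
    _ ≤ (∑ i, ∏ k, ((‖x k i‖ / ‖x k‖) ^ (p k).toReal) ^ w k) * ∏ k, ‖x k‖ := by
        gcongr with i _ k
        exact hcoord k i
    _ ≤ (n : ℝ) ^ (1 - ∑ k, w k) * ∏ k, ‖x k‖ := by
        gcongr
        refine sum_prod_rpow_le_card_rpow n hn w _ hw hw1 (fun k i => by positivity) fun k => ?_
        by_cases hp : p k = ⊤
        · have h0 : w k = 0 := le_antisymm (by simpa [hp] using hwp k) (hw k)
          simp [h0]
        · exact mul_le_of_le_one_right (hw k) (sum_norm_coord_div_norm_rpow_le_one hp _)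

lemma lpUnit_apply (p : ℝ≥0∞) (n : ℕ) [Fact (1 ≤ p)] (i j : Fin n) :
    lpUnit p n i j = if j = i then 1 else 0 := by
  simp [lpUnit]

/-- On the diagonal the form which is constant in the variable `l` takes the value one. -/
lemma sumProdForm_lpUnit_diagonal {m n : ℕ} (p : Fin m → ℝ≥0∞) [∀ k, Fact (1 ≤ p k)]
    (l l' : Fin m) (hl : l' ≠ l) (z i : Fin n) :
    sumProdForm p (fun k i => if k = l then z else i)
      (fun j => lpUnit (p j) n (if j = l then z else i)) = 1 := by
  rw [sumProdForm_apply, sum_eq_single i]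
  · exact prod_eq_one fun k _ => by simp [lpUnit_apply]
  · intro j _ hj
    exact prod_eq_zero (mem_univ l') (by simp [lpUnit_apply, hl, hj])
  · simp

lemma sum_diagonal_le_sum_filter {m n : ℕ} (l l' : Fin m) (hl : l' ≠ l) (z : Fin n)
    (F : (Fin m → Fin n) → ℝ) (hF : ∀ is, 0 ≤ F is) :
    ∑ i, F (fun j => if j = l then z else i) ≤
      ∑ is ∈ univ.filter (fun is : Fin m → Fin n => is l = z), F is := by
  have hinj : Function.Injective (fun (i : Fin n) (j : Fin m) => if j = l then z else i) :=
    fun i j h => by simpa [hl] using congrFun h l'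
  rw [← sum_image (f := F) hinj.injOn]
  refine sum_le_sum_of_subset_of_nonneg ?_ fun is _ _ => hF is
  intro is his
  obtain ⟨i, -, rfl⟩ := mem_image.1 his
  simp

/-- The mixed norm of the form constant in the variable `l` is at least `√n`. -/
lemma sqrt_card_le_mixedNorm {m n : ℕ} (p : Fin m → ℝ≥0∞) [∀ k, Fact (1 ≤ p k)]
    (l l' : Fin m) (hl : l' ≠ l) (z : Fin n) (θ : ℝ) (hθ : 0 < θ) :
    (n : ℝ) ^ (1 / 2 : ℝ) ≤
      (∑ i : Fin n, (∑ is ∈ univ.filter (fun is : Fin m → Fin n => is l = i),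
        ‖sumProdForm p (fun k i => if k = l then z else i)
          (fun j => lpUnit (p j) n (is j))‖ ^ 2) ^ (θ / 2)) ^ (1 / θ) := by
  set A := sumProdForm p (fun k i => if k = l then z else i) with hA
  have hinner : (n : ℝ) ≤ ∑ is ∈ univ.filter (fun is : Fin m → Fin n => is l = z),
      ‖A (fun j => lpUnit (p j) n (is j))‖ ^ 2 := by
    have hdiag : ∀ i, ‖A (fun j => lpUnit (p j) n (if j = l then z else i))‖ ^ 2 = 1 :=
      fun i => by rw [hA, sumProdForm_lpUnit_diagonal p l l' hl]; simp
    calc (n : ℝ) = ∑ i : Fin n, (1 : ℝ) := by simp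
      _ = ∑ i, ‖A (fun j => lpUnit (p j) n (if j = l then z else i))‖ ^ 2 :=
          sum_congr rfl fun i _ => (hdiag i).symm
      _ ≤ _ := sum_diagonal_le_sum_filter l l' hl z
          (fun is => ‖A (fun j => lpUnit (p j) n (is j))‖ ^ 2) (fun _ => by positivity)
  calc (n : ℝ) ^ (1 / 2 : ℝ) = ((n : ℝ) ^ (θ / 2)) ^ (1 / θ) := by
        rw [← Real.rpow_mul (by positivity)]
        congr 1
        field_simp
    _ ≤ ((∑ is ∈ univ.filter (fun is : Fin m → Fin n => is l = z),
          ‖A (fun j => lpUnit (p j) n (is j))‖ ^ 2) ^ (θ / 2)) ^ (1 / θ) := by gcongr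
    _ ≤ _ := by
        gcongr
        exact single_le_sum (f := fun i => (∑ is ∈ univ.filter
            (fun is : Fin m → Fin n => is l = i),
            ‖A (fun j => lpUnit (p j) n (is j))‖ ^ 2) ^ (θ / 2))
          (fun i _ => by positivity) (mem_univ z)

/-- Weights dominated by `1 / p k`, vanishing off `S`, with total in `(1/2, 1]`. -/
lemma exists_weights {m : ℕ} (p : Fin m → ℝ≥0∞) [∀ k, Fact (1 ≤ p k)]
    (S : Finset (Fin m)) (hbig : (1 / 2 : ℝ≥0∞) < ∑ k ∈ S, (p k)⁻¹) :
    ∃ w : Fin m → ℝ, (∀ k, 0 ≤ w k) ∧ (∀ k, w k ≤ (p k)⁻¹.toReal) ∧ (∀ k ∉ S, w k = 0) ∧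
      1 / 2 < ∑ k, w k ∧ ∑ k, w k ≤ 1 := by
  have hfin : ∀ k ∈ S, (p k)⁻¹ ≠ ⊤ := fun k _ =>
    ENNReal.inv_ne_top.2 (zero_lt_one.trans_le (Fact.out : 1 ≤ p k)).ne'
  set s := ∑ k ∈ S, (p k)⁻¹.toReal with hs
  have hs2 : 1 / 2 < s := by
    have h := (ENNReal.toReal_lt_toReal (by simp) (ENNReal.sum_ne_top.2 hfin)).2 hbig
    rw [ENNReal.toReal_sum hfin] at h
    simpa [hs] using h
  have hs0 : 0 < s := by linarith
  have hmin : 1 / 2 < min s 1 := lt_min hs2 (by norm_num)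
  have hsum : ∑ k, (if k ∈ S then min s 1 / s * (p k)⁻¹.toReal else 0) = min s 1 := by
    rw [sum_ite_mem, univ_inter, ← mul_sum, ← hs]
    field_simp
  refine ⟨fun k => if k ∈ S then min s 1 / s * (p k)⁻¹.toReal else 0, ?_, ?_, ?_, ?_, ?_⟩
  · intro k
    dsimp only
    split_ifs
    · exact mul_nonneg (div_nonneg (by linarith) hs0.le) ENNReal.toReal_nonneg
    · exact le_rfl
  · intro k
    dsimp only
    split_ifs
    · exact mul_le_of_le_one_left ENNReal.toReal_nonneg
        (div_le_one_of_le₀ (min_le_left _ _) hs0.le)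
    · exact ENNReal.toReal_nonneg
  · intro k hk
    simp [hk]
  · rwa [hsum]
  · rw [hsum]
    exact min_le_right _ _

end

/-- **Section 6.4: necessity of the summability condition in the mixed `(ℓ_λ, ℓ_2)`-norm
inequality.** Let `m ≥ 2`, `p₁, …, p_{m-1} ∈ [2,∞]` with `1/p₁ + ⋯ + 1/p_{m-1} > 1/2`, and
`p_m ∈ [1,∞]`. Then for every `θ > 0` there is no constant `C > 0` such that every `m`-linear
form `A : ℓ_{p₁}^n × ⋯ × ℓ_{p_m}^n → ℂ` satisfies
`(Σ_{i_m} (Σ_{i₁,…,i_{m-1}} |A(e_{i₁},…,e_{i_m})|²)^{θ/2})^{1/θ} ≤ C‖A‖`. -/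
theorem mixed_norm_condition_necessary (m : ℕ) (hm : 2 ≤ m)
    (p : Fin m → ℝ≥0∞) [∀ k, Fact (1 ≤ p k)]
    (hp2 : ∀ k : Fin m, (k : ℕ) < m - 1 → 2 ≤ p k)
    (hbig : (1 / 2 : ℝ≥0∞) <
      ∑ k ∈ Finset.univ.filter (fun k : Fin m => (k : ℕ) < m - 1), (p k)⁻¹) :
    ∀ θ : ℝ, 0 < θ →
      ¬ ∃ C : ℝ, 0 < C ∧
        ∀ (n : ℕ), 1 ≤ n →
        ∀ A : ContinuousMultilinearMap ℂ (fun k => PiLp (p k) (fun _ : Fin n => ℂ)) ℂ,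
          (∑ i : Fin n,
              (∑ is ∈ Finset.univ.filter
                  (fun is : Fin m → Fin n => is ⟨m - 1, by omega⟩ = i),
                  ‖A (fun j => lpUnit (p j) n (is j))‖ ^ 2) ^ (θ / 2)) ^ (1 / θ) ≤
            C * ‖A‖ := by
  rintro θ hθ ⟨C, hC, h⟩
  obtain ⟨w, hw0, hwp, hwS, hwlo, hwhi⟩ := exists_weights p _ hbig
  set σ := ∑ k, w k with hσ
  have hl : (⟨0, by omega⟩ : Fin m) ≠ ⟨m - 1, by omega⟩ := by
    simp only [ne_eq, Fin.mk.injEq]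
    omega
  have key : ∀ n : ℕ, 1 ≤ n → (n : ℝ) ^ (σ - 1 / 2) ≤ C := by
    intro n hn
    have hn0 : (0 : ℝ) < n := by exact_mod_cast hn
    have hnorm := norm_sumProdForm_le hn p
      (fun k i => if k = ⟨m - 1, by omega⟩ then (⟨0, hn⟩ : Fin n) else i) w hw0 hwhi hwp
      (fun k => by
        by_cases hk : k = ⟨m - 1, by omega⟩
        · exact Or.inl (hwS k (by simp [hk]))
        · exact Or.inr fun i => by simp [hk])
    have hle : (n : ℝ) ^ (1 / 2 : ℝ) ≤ C * (n : ℝ) ^ (1 - σ) :=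
      (sqrt_card_le_mixedNorm p _ _ hl (⟨0, hn⟩ : Fin n) θ hθ).trans
        ((h n hn _).trans (by gcongr))
    calc (n : ℝ) ^ (σ - 1 / 2) = (n : ℝ) ^ (1 / 2 : ℝ) / (n : ℝ) ^ (1 - σ) := by
          rw [← Real.rpow_sub hn0]
          congr 1
          ring
      _ ≤ C := (div_le_iff₀ (Real.rpow_pos_of_pos hn0 _)).2 hle
  have hlim := (tendsto_rpow_atTop (show 0 < σ - 1 / 2 by linarith)).comp
    tendsto_natCast_atTop_atTop
  obtain ⟨n, hn, hn1⟩ := ((hlim.eventually_gt_atTop C).and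
    (Filter.eventually_ge_atTop 1)).exists
  exact absurd (key n hn1) (not_le.2 hn)
end
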